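/- arXiv:2309.12623 — 2 statements merged into one kernel-verified Lean document; each statement's English description precedes it below -/
import Mathlib

section
/- Let σ be a finite list of N items from U (an insertion-only stream) and for x : U let f(x) be the number of occurrences of x in σ. After SpaceSaving with m ≥ 1 counters processes σ, for every x : U, |f(x) − Ŝ(x)| ≤ N/m (as real numbers). -/
/-!
The insertion-only SpaceSaving summary, formalized as an association list
`List (U × ℕ)` of (item, count) entries.
-/

namespace SSPM

variable {U : Type} [DecidableEq U]

/-- State of SpaceSaving: association list of (item, count). -/
abbrev SSState (U : Type) := List (U × ℕ)

/-- One step of the SpaceSaving update algorithm with `m` counters: if the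
arriving item is monitored, increment its count; else if the summary is not
full, add it with count 1; otherwise evict an entry of minimal count `w`
(ties broken by a fixed rule: the first minimal entry) and add the new item
with count `w + 1`. -/
def ssStep (m : ℕ) (S : SSState U) (e : U) : SSState U :=
  match S.find? (fun q => q.1 == e) with
  | some q => (e, q.2 + 1) :: S.eraseP (fun q => q.1 == e)
  | none =>
    if S.length < m then (e, 1) :: S
    else
      match S.argmin (fun q => q.2) with
      | some q => (e, q.2 + 1) :: S.eraseP (fun r => r.1 == q.1)
      | none => S

/-- Run SpaceSaving with `m` counters on a list of items. -/
def ssRun (m : ℕ) (l : List U) : SSState U := l.foldl (ssStep m) []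

/-- Query `Ŝ(x)`: the count of `x` if monitored, `0` otherwise. -/
def ssQuery (S : SSState U) (x : U) : ℕ :=
  match S.find? (fun q => q.1 == x) with
  | some q => q.2
  | none => 0
/-- The invariant of SpaceSaving with `m` counters after processing `l`: the number `b` bounds
the error of every count from above and every stored count from below. -/
structure SSInvariant (m : ℕ) (l : List U) (S : SSState U) (b : ℕ) : Prop where
  nodup : (S.map Prod.fst).Nodup
  sum_eq : (S.map Prod.snd).sum = l.length
  eq_zero_of_lt : S.length < m → b = 0
  mul_le : m * b ≤ l.length
  le_snd : ∀ q ∈ S, b ≤ q.2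
  count_le : ∀ q ∈ S, l.count q.1 ≤ q.2
  le_count_add : ∀ q ∈ S, q.2 ≤ l.count q.1 + b
  count_le_of_notMem : ∀ y, y ∉ S.map Prod.fst → l.count y ≤ b

theorem SSInvariant.perm {m b : ℕ} {l : List U} {S T : SSState U} (h : SSInvariant m l S b)
    (p : S.Perm T) : SSInvariant m l T b where
  nodup := (p.map _).nodup_iff.1 h.nodup
  sum_eq := (p.map Prod.snd).sum_eq.symm.trans h.sum_eq
  eq_zero_of_lt hT := h.eq_zero_of_lt (p.length_eq ▸ hT)
  mul_le := h.mul_le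
  le_snd q hq := h.le_snd q (p.mem_iff.2 hq)
  count_le q hq := h.count_le q (p.mem_iff.2 hq)
  le_count_add q hq := h.le_count_add q (p.mem_iff.2 hq)
  count_le_of_notMem y hy := h.count_le_of_notMem y fun hm => hy ((p.map _).mem_iff.1 hm)

theorem SSInvariant.nil (m : ℕ) : SSInvariant m ([] : List U) [] 0 := by
  constructor <;> simp

theorem perm_cons_eraseP {S : SSState U} (hS : (S.map Prod.fst).Nodup) {q : U × ℕ}
    (hq : q ∈ S) : S.Perm (q :: S.eraseP (fun r => r.1 == q.1)) := by
  induction S with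
  | nil => simp at hq
  | cons a S ih =>
    rw [List.map_cons, List.nodup_cons] at hS
    rcases List.mem_cons.1 hq with rfl | hq
    · simp
    · have hne : a.1 ≠ q.1 := fun h => hS.1 (h ▸ List.mem_map_of_mem hq)
      rw [List.eraseP_cons_of_neg (by simpa using hne)]
      exact ((ih hS.2 hq).cons a).trans (List.Perm.swap _ _ _)

theorem notMem_map_fst_of_find?_eq_none {S : SSState U} {x : U}
    (h : S.find? (fun q => q.1 == x) = none) : x ∉ S.map Prod.fst := by
  rw [List.find?_eq_none] at h
  intro hx
  obtain ⟨q, hq, rfl⟩ := List.mem_map.1 hx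
  exact h q hq (beq_self_eq_true _)

theorem SSInvariant.increment {m b : ℕ} {l : List U} {T : SSState U} {e : U} {c : ℕ}
    (h : SSInvariant m l ((e, c) :: T) b) : SSInvariant m (l ++ [e]) ((e, c + 1) :: T) b := by
  obtain ⟨h1, h2, h3, h4, h5, h6, h7, h8⟩ := h
  simp only [List.map_cons, List.nodup_cons, List.sum_cons, List.length_cons,
    List.mem_cons, or_imp, forall_and, forall_eq, not_or] at h1 h2 h3 h5 h6 h7 h8
  have hc : ∀ q ∈ T, (l ++ [e]).count q.1 = l.count q.1 := fun q hq => by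
    have : e ≠ q.1 := fun h => h1.1 (h ▸ List.mem_map_of_mem hq)
    simp [List.count_append, this]
  constructor <;> simp only [List.map_cons, List.nodup_cons, List.sum_cons, List.length_cons,
    List.mem_cons, or_imp, forall_and, forall_eq, not_or, List.length_append, List.length_nil]
  · exact h1
  · omega
  · exact h3
  · omega
  · exact ⟨by omega, h5.2⟩
  · refine ⟨by simpa [List.count_append] using h6.1, fun q hq => ?_⟩
    rw [hc q hq]; exact h6.2 q hq
  · refine ⟨?_, fun q hq => ?_⟩
    · simp only [List.count_append, List.count_singleton_self]; omega
    · rw [hc q hq]; exact h7.2 q hq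
  · intro y hy
    simpa [List.count_append, Ne.symm hy.1] using h8 y hy

theorem SSInvariant.insert {m b : ℕ} {l : List U} {S : SSState U} {e : U}
    (h : SSInvariant m l S b) (he : e ∉ S.map Prod.fst) (hlt : S.length < m) :
    SSInvariant m (l ++ [e]) ((e, 1) :: S) b := by
  obtain ⟨h1, h2, h3, h4, h5, h6, h7, h8⟩ := h
  obtain rfl := h3 hlt
  have hc : ∀ q ∈ S, (l ++ [e]).count q.1 = l.count q.1 := fun q hq => by
    have : e ≠ q.1 := fun h => he (h ▸ List.mem_map_of_mem hq)
    simp [List.count_append, this]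
  have he0 := h8 e he
  constructor <;> simp only [List.map_cons, List.nodup_cons, List.sum_cons, List.length_cons,
    List.mem_cons, or_imp, forall_and, forall_eq, not_or, List.length_append, List.length_nil]
  · exact ⟨he, h1⟩
  · omega
  · simp
  · simp
  · simp
  · refine ⟨by simpa [List.count_append] using he0, fun q hq => ?_⟩
    rw [hc q hq]; exact h6 q hq
  · refine ⟨by simp [List.count_append], fun q hq => ?_⟩
    rw [hc q hq]; exact h7 q hq
  · intro y hy
    simpa [List.count_append, Ne.symm hy.1] using h8 y hy.2

theorem SSInvariant.evict {m b : ℕ} {l : List U} {T : SSState U} {e : U} {q : U × ℕ}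
    (h : SSInvariant m l (q :: T) b) (he : e ∉ (q :: T).map Prod.fst)
    (hle : m ≤ (q :: T).length) (hmin : ∀ r ∈ T, q.2 ≤ r.2) :
    SSInvariant m (l ++ [e]) ((e, q.2 + 1) :: T) q.2 := by
  obtain ⟨h1, h2, h3, h4, h5, h6, h7, h8⟩ := h
  have he0 := h8 e he
  simp only [List.map_cons, List.nodup_cons, List.sum_cons, List.length_cons,
    List.mem_cons, or_imp, forall_and, forall_eq, not_or] at h1 h2 h3 h5 h6 h7 h8 he hle
  have hsum : T.length * q.2 ≤ (T.map Prod.snd).sum := by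
    simpa using List.card_nsmul_le_sum (T.map Prod.snd) q.2 (by simpa using fun r c hr => hmin _ hr)
  have hc : ∀ r ∈ T, (l ++ [e]).count r.1 = l.count r.1 := fun r hr => by
    have : e ≠ r.1 := fun h => he.2 (h ▸ List.mem_map_of_mem hr)
    simp [List.count_append, this]
  constructor <;> simp only [List.map_cons, List.nodup_cons, List.sum_cons, List.length_cons,
    List.mem_cons, or_imp, forall_and, forall_eq, not_or, List.length_append, List.length_nil]
  · exact ⟨he.2, h1.2⟩
  · omega
  · omega
  · nlinarith [Nat.mul_le_mul_right q.2 hle]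
  · exact ⟨by omega, hmin⟩
  · refine ⟨?_, fun r hr => ?_⟩
    · simp only [List.count_append, List.count_singleton_self]; omega
    · rw [hc r hr]; exact h6.2 r hr
  · refine ⟨?_, fun r hr => ?_⟩
    · simp only [List.count_append, List.count_singleton_self]; omega
    · rw [hc r hr]; have := h7.2 r hr; omega
  · intro y hy
    have hy' : (l ++ [e]).count y = l.count y := by
      simp [List.count_append, Ne.symm hy.1]
    rw [hy']
    by_cases hyq : y = q.1
    · exact hyq ▸ h6.1
    · exact (h8 y ⟨hyq, hy.2⟩).trans h5.1

theorem SSInvariant.step {m b : ℕ} (hm : 1 ≤ m) {l : List U} {S : SSState U}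
    (h : SSInvariant m l S b) (e : U) : ∃ b', SSInvariant m (l ++ [e]) (ssStep m S e) b' := by
  unfold ssStep
  split
  next q hq =>
    obtain rfl : q.1 = e := by simpa using List.find?_some hq
    exact ⟨b, (h.perm (perm_cons_eraseP h.nodup (List.mem_of_find?_eq_some hq))).increment⟩
  next hnone =>
    have he := notMem_map_fst_of_find?_eq_none hnone
    split_ifs with hlt
    · exact ⟨b, h.insert he hlt⟩
    · split
      next q hq =>
        have hqS : q ∈ S := List.argmin_mem hq
        have p := perm_cons_eraseP h.nodup hqS
        refine ⟨q.2, (h.perm p).evict (fun hm => he ((p.map _).mem_iff.2 hm)) ?_ fun r hr => ?_⟩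
        · rw [← p.length_eq]; omega
        · exact List.le_of_mem_argmin (List.mem_of_mem_eraseP hr) hq
      next hq =>
        rw [List.argmin_eq_none] at hq
        simp [hq] at hlt
        omega

theorem exists_ssInvariant_ssRun {m : ℕ} (hm : 1 ≤ m) (l : List U) :
    ∃ b, SSInvariant m l (ssRun m l) b := by
  induction l using List.reverseRecOn with
  | nil => exact ⟨0, SSInvariant.nil m⟩
  | append_singleton l e ih =>
    obtain ⟨b, h⟩ := ih
    simpa [ssRun] using h.step hm e

theorem SSInvariant.ssQuery_bounds {m b : ℕ} {l : List U} {S : SSState U}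
    (h : SSInvariant m l S b) (x : U) :
    l.count x ≤ ssQuery S x + b ∧ ssQuery S x ≤ l.count x + b := by
  unfold ssQuery
  split
  next q hq =>
    obtain rfl : q.1 = x := by simpa using List.find?_some hq
    have hqS := List.mem_of_find?_eq_some hq
    exact ⟨(h.count_le q hqS).trans (Nat.le_add_right _ _), h.le_count_add q hqS⟩
  next hnone =>
    have := h.count_le_of_notMem x (notMem_map_fst_of_find?_eq_none hnone)
    omega

/-- Let σ be a finite list of N items from U (an insertion-only
stream) and for x let f(x) be the number of occurrences of x in σ. After
SpaceSaving with m ≥ 1 counters processes σ, for every x,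
|f(x) − Ŝ(x)| ≤ N/m (as real numbers). -/
theorem ss_error_bound (m : ℕ) (hm : 1 ≤ m) (σ : List U) (x : U) :
    |(σ.count x : ℝ) - (ssQuery (ssRun m σ) x : ℝ)| ≤ (σ.length : ℝ) / (m : ℝ) := by
  obtain ⟨b, h⟩ := exists_ssInvariant_ssRun hm σ
  obtain ⟨h₁, h₂⟩ := h.ssQuery_bounds x
  have hb : (b : ℝ) ≤ (σ.length : ℝ) / (m : ℝ) := by
    rw [le_div_iff₀ (by exact_mod_cast hm), mul_comm]
    exact_mod_cast h.mul_le
  have h₁' : (σ.count x : ℝ) ≤ ssQuery (ssRun m σ) x + b := by exact_mod_cast h₁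
  have h₂' : (ssQuery (ssRun m σ) x : ℝ) ≤ σ.count x + b := by exact_mod_cast h₂
  rw [abs_le]
  constructor <;> linarith

end SSPM
end

section
/- Let ε > 0 and α ≥ 1, and let σ be a valid α-bounded-deletion stream with no interleaving, i.e. every insertion operation of σ precedes every deletion operation of σ. If m ≥ α/ε, then after SpaceSaving± with m counters processes σ, for every x : U, |f(x) − Ŝ(x)| ≤ ε·F1. -/
/-!
Streams of insert/delete operations over a universe `U`, the insertion-only
SpaceSaving summary (association list `List (U × ℕ)` of (item, count) entries),
and the Double SpaceSaving± algorithm, which runs one SpaceSaving summary on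
the inserted items and one on the deleted items. `true` encodes an insertion,
`false` a deletion.
-/

namespace SSPM

variable {U : Type} [DecidableEq U]

/-- A stream: list of (item, operation) pairs; `true` = insertion, `false` = deletion. -/
abbrev Stream (U : Type) := List (U × Bool)

/-- Number of insertions of `x` in `σ`. -/
def insCount (σ : Stream U) (x : U) : ℕ := σ.countP (fun p => p.1 == x && p.2)

/-- Number of deletions of `x` in `σ`. -/
def delCount (σ : Stream U) (x : U) : ℕ := σ.countP (fun p => p.1 == x && !p.2)

/-- Total number of insertion operations `I`. -/
def totalI (σ : Stream U) : ℕ := σ.countP (fun p => p.2)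

/-- Total number of deletion operations `D`. -/
def totalD (σ : Stream U) : ℕ := σ.countP (fun p => !p.2)

/-- Frequency `f(x) = I(x) - D(x)`. -/
def freq (σ : Stream U) (x : U) : ℤ := (insCount σ x : ℤ) - (delCount σ x : ℤ)

/-- `F1 = I - D`. -/
def F1 (σ : Stream U) : ℤ := (totalI σ : ℤ) - (totalD σ : ℤ)

/-- A stream is valid if in every prefix every item has at least as many
insertions as deletions. -/
def Valid (σ : Stream U) : Prop :=
  ∀ τ : Stream U, τ <+: σ → ∀ x : U, delCount τ x ≤ insCount τ x

/-- `α`-bounded-deletion property: `D ≤ (1 - 1/α) I`. -/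
def BoundedDel (α : ℝ) (σ : Stream U) : Prop :=
  (totalD σ : ℝ) ≤ (1 - 1 / α) * (totalI σ : ℝ)

/-- The subsequence of items inserted in `σ`. -/
def insSeq (σ : Stream U) : List U := (σ.filter (fun p => p.2)).map Prod.fst

/-- The subsequence of items deleted in `σ`. -/
def delSeq (σ : Stream U) : List U := (σ.filter (fun p => !p.2)).map Prod.fst

/-- Double SpaceSaving± query:
`f̂(x) = max(Ŝ_insert(x) − Ŝ_delete(x), 0)` where `S_insert = ssRun mI (insSeq σ)`
and `S_delete = ssRun mD (delSeq σ)`. -/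
def dssQuery (mI mD : ℕ) (σ : Stream U) (x : U) : ℤ :=
  max ((ssQuery (ssRun mI (insSeq σ)) x : ℤ) - (ssQuery (ssRun mD (delSeq σ)) x : ℤ)) 0

/-- One step of the original SpaceSaving± update algorithm with `m` counters:
insertions are processed as in SpaceSaving; a deletion of a monitored item
decrements its counter; deletions of unmonitored items are ignored. -/
def sspmStep (m : ℕ) (S : SSState U) (p : U × Bool) : SSState U :=
  match p with
  | (e, true) => ssStep m S e
  | (e, false) =>
    match S.find? (fun q => q.1 == e) with
    | some q => (e, q.2 - 1) :: S.eraseP (fun q => q.1 == e)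
    | none => S

/-- Run SpaceSaving± with `m` counters on stream `σ`. -/
def sspmRun (m : ℕ) (σ : Stream U) : SSState U := σ.foldl (sspmStep m) []

theorem perm_cons_eraseP_of_find? {β : Type} {p : β → Bool} {l : List β} {a : β}
    (h : l.find? p = some a) : l.Perm (a :: l.eraseP p) := by
  induction l with
  | nil => simp at h
  | cons b l ih =>
    by_cases hb : p b
    · simp_all
    · simp only [List.find?_cons, hb] at h
      simpa [hb] using ((ih h).cons b).trans (List.Perm.swap a b _)

theorem notMem_keys_of_find?_eq_none {S : SSState U} {e : U}
    (h : S.find? (fun q => q.1 == e) = none) : e ∉ S.map Prod.fst := by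
  intro he
  obtain ⟨q, hq, rfl⟩ := List.mem_map.1 he
  simpa using List.find?_eq_none.1 h q hq

/-- The SpaceSaving invariant: `S` summarizes an insertion-only stream with frequencies `f`
and length `N`, with error at most `M`, which is positive only if all `m` counters are in use
and hold at least `M`. -/
structure Summarizes (m : ℕ) (S : SSState U) (f : U → ℕ) (N M : ℕ) : Prop where
  nodup : (S.map Prod.fst).Nodup
  sum_eq : (S.map Prod.snd).sum = N
  full : M = 0 ∨ (m ≤ S.length ∧ ∀ q ∈ S, M ≤ q.2)
  le_count : ∀ q ∈ S, f q.1 ≤ q.2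
  count_le : ∀ q ∈ S, q.2 ≤ f q.1 + M
  unmonitored : ∀ x, x ∉ S.map Prod.fst → f x ≤ M

omit [DecidableEq U] in
theorem Summarizes.perm {m : ℕ} {S T : SSState U} {f : U → ℕ} {N M : ℕ}
    (h : Summarizes m S f N M) (hp : S.Perm T) : Summarizes m T f N M where
  nodup := (hp.map _).nodup_iff.1 h.nodup
  sum_eq := (hp.map Prod.snd).sum_eq.symm.trans h.sum_eq
  full := by
    simpa only [hp.length_eq, hp.mem_iff] using h.full
  le_count q hq := h.le_count q (hp.mem_iff.2 hq)
  count_le q hq := h.count_le q (hp.mem_iff.2 hq)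
  unmonitored x hx := h.unmonitored x fun hm => hx ((hp.map _).mem_iff.1 hm)

omit [DecidableEq U] in
theorem Summarizes.mul_le {m : ℕ} {S : SSState U} {f : U → ℕ} {N M : ℕ}
    (h : Summarizes m S f N M) : M * m ≤ N := by
  rcases h.full with h0 | ⟨hl, hM⟩
  · simp [h0]
  · have := List.card_nsmul_le_sum (S.map Prod.snd) M (by
      intro c hc
      obtain ⟨q, hq, rfl⟩ := List.mem_map.1 hc
      exact hM q hq)
    rw [h.sum_eq, List.length_map, smul_eq_mul] at this
    calc M * m ≤ M * S.length := by gcongr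
      _ = S.length * M := mul_comm _ _
      _ ≤ N := this

theorem Summarizes.ssStep {m : ℕ} (hm : 0 < m) {S : SSState U} {f : U → ℕ} {N M : ℕ}
    (h : Summarizes m S f N M) (e : U) :
    ∃ M', Summarizes m (ssStep m S e) (Function.update f e (f e + 1)) (N + 1) M' := by
  unfold SSPM.ssStep
  split
  next q hq =>
    have hp := h.perm (perm_cons_eraseP_of_find? hq)
    have hqe : q.1 = e := by simpa using List.find?_some hq
    obtain ⟨k, c⟩ := q
    subst hqe
    generalize S.eraseP _ = T at hp
    obtain ⟨h1, h2, h3, h4, h5, h6⟩ := hp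
    refine ⟨M, ?_, ?_, ?_, ?_, ?_, ?_⟩
    · simpa using h1
    · simp at h2 ⊢; omega
    · simp at h3 ⊢; grind
    · simp at h1 h4 ⊢; grind
    · simp at h1 h5 ⊢; grind
    · simp at h6 ⊢; grind
  next hn =>
    have he := notMem_keys_of_find?_eq_none hn
    have hfe := h.unmonitored e he
    split_ifs with hl
    · obtain ⟨h1, h2, h3, h4, h5, h6⟩ := h
      have hM : M = 0 := by omega
      refine ⟨0, ?_, ?_, Or.inl rfl, ?_, ?_, ?_⟩
      · simpa using ⟨by simpa using he, h1⟩
      · simp at h2 ⊢; omega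
      · simp at he h4 ⊢; grind
      · simp at he h5 ⊢; grind
      · simp at h6 ⊢; grind
    · split
      next q hq =>
        have hqS : q ∈ S := List.argmin_mem hq
        have hmin : ∀ r ∈ S, q.2 ≤ r.2 := fun r hr => List.le_of_mem_argmin hr hq
        have hMq : M ≤ q.2 := by
          rcases h.full with h0 | h0
          · omega
          · exact h0.2 q hqS
        obtain ⟨r, hr⟩ : ∃ r, S.find? (fun r => r.1 == q.1) = some r :=
          Option.isSome_iff_exists.1 (List.find?_isSome.2 ⟨q, hqS, by simp⟩)
        obtain rfl : r = q :=
          List.inj_on_of_nodup_map h.nodup (List.mem_of_find?_eq_some hr) hqS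
            (by simpa using List.find?_some hr)
        have hperm := perm_cons_eraseP_of_find? hr
        have hp := h.perm hperm
        have hlen := hperm.length_eq
        simp only [hperm.mem_iff] at hmin
        rw [(hperm.map _).mem_iff] at he
        generalize S.eraseP _ = T at *
        obtain ⟨k, c⟩ := r
        obtain ⟨h1, h2, h3, h4, h5, h6⟩ := hp
        refine ⟨c, ?_, ?_, ?_, ?_, ?_, ?_⟩
        · simp at h1 he ⊢; grind
        · simp at h2 ⊢; omega
        · right
          simp at hmin hlen ⊢; grind
        · simp at he h4 ⊢; grind
        · simp at he h5 ⊢; grind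
        · intro x hx
          simp only [List.map_cons, List.mem_cons, not_or] at hx
          rw [Function.update_of_ne hx.1]
          by_cases hxk : x = k
          · subst hxk
            exact h4 (x, c) (by simp)
          · exact (h6 x (by simp only [List.map_cons, List.mem_cons]; tauto)).trans hMq
      next hq =>
        rw [List.argmin_eq_none] at hq
        subst hq
        simp at hl
        omega

theorem exists_summarizes_sspmRun {m : ℕ} (hm : 0 < m) (σ : Stream U)
    (hσ : ∀ p ∈ σ, p.2 = true) :
    ∃ M, Summarizes m (sspmRun m σ) (insCount σ) (totalI σ) M := by
  induction σ using List.reverseRecOn with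
  | nil => exact ⟨0, by simp [sspmRun], by simp [sspmRun, totalI], Or.inl rfl,
      by simp [sspmRun], by simp [sspmRun], by simp [insCount]⟩
  | append_singleton σ p ih =>
    obtain ⟨e, b⟩ := p
    obtain rfl : b = true := hσ (e, b) (by simp)
    obtain ⟨M, h⟩ := ih fun p hp => hσ p (by simp [hp])
    obtain ⟨M', h'⟩ := h.ssStep hm e
    refine ⟨M', ?_⟩
    have hI : totalI (σ ++ [(e, true)]) = totalI σ + 1 := by simp [totalI]
    have hf : insCount (σ ++ [(e, true)]) =
        Function.update (insCount σ) e (insCount σ e + 1) := by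
      ext x
      by_cases hx : x = e
      · subst hx; simp [insCount]
      · simp [insCount, hx, Ne.symm hx]
    rw [hI, hf]
    simpa [sspmRun, sspmStep] using h'

theorem Summarizes.ssQuery_bounds {m : ℕ} {S : SSState U} {f : U → ℕ} {N M : ℕ}
    (h : Summarizes m S f N M) (x : U) :
    (f x ≤ ssQuery S x ∧ ssQuery S x ≤ f x + M) ∨ (ssQuery S x = 0 ∧ f x ≤ M) := by
  unfold ssQuery
  split
  next q hq =>
    have hqS := List.mem_of_find?_eq_some hq
    obtain rfl : q.1 = x := by simpa using List.find?_some hq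
    exact Or.inl ⟨h.le_count q hqS, h.count_le q hqS⟩
  next hn => exact Or.inr ⟨rfl, h.unmonitored x (notMem_keys_of_find?_eq_none hn)⟩

theorem find?_eraseP_of_disjoint {β : Type} {p r : β → Bool} (h : ∀ a, p a → ¬ r a)
    (l : List β) : (l.eraseP p).find? r = l.find? r := by
  induction l with
  | nil => rfl
  | cons a l ih =>
    by_cases ha : p a
    · simp [ha, h a ha]
    · simp [ha, List.find?_cons, ih]

theorem ssQuery_sspmStep_del (m : ℕ) (S : SSState U) (e x : U) :
    ssQuery (sspmStep m S (e, false)) x = ssQuery S x - if e = x then 1 else 0 := by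
  by_cases hx : e = x
  · subst hx
    cases hq : S.find? (fun q => q.1 == e) <;> simp [sspmStep, ssQuery, hq]
  · have hd : ∀ a : U × ℕ, (a.1 == e) = true → ¬ (a.1 == x) = true := by grind
    cases hq : S.find? (fun q => q.1 == e) <;>
      simp [sspmStep, ssQuery, hq, hx, find?_eraseP_of_disjoint hd]

theorem ssQuery_foldl_del (m : ℕ) (σ : Stream U) (hσ : ∀ p ∈ σ, p.2 = false)
    (S : SSState U) (x : U) :
    ssQuery (σ.foldl (sspmStep m) S) x = ssQuery S x - delCount σ x := by
  induction σ generalizing S with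
  | nil => simp [delCount]
  | cons p σ ih =>
    obtain ⟨e, b⟩ := p
    obtain rfl : b = false := hσ (e, b) (by simp)
    rw [List.foldl_cons, ih (fun p hp => hσ p (by simp [hp])), ssQuery_sspmStep_del]
    simp [delCount, List.countP_cons]
    omega

/-- Let ε > 0 and α ≥ 1, and let σ be a valid α-bounded-deletion
stream with no interleaving (every insertion operation precedes every deletion
operation). If m ≥ α/ε, then after SpaceSaving± with m counters processes σ,
for every x, |f(x) − Ŝ(x)| ≤ ε·F1. -/
theorem sspm_no_interleaving_error_bound (ε α : ℝ) (hε : 0 < ε) (hα : 1 ≤ α)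
    (σ : Stream U) (hv : Valid σ) (hb : BoundedDel α σ)
    (hni : ∃ σI σD : Stream U, σ = σI ++ σD ∧
      (∀ p ∈ σI, p.2 = true) ∧ (∀ p ∈ σD, p.2 = false))
    (m : ℕ) (hm : α / ε ≤ (m : ℝ)) (x : U) :
    |(freq σ x : ℝ) - (ssQuery (sspmRun m σ) x : ℝ)| ≤ ε * (F1 σ : ℝ) := by
  obtain ⟨σI, σD, rfl, hI, hD⟩ := hni
  have hα0 : 0 < α := by linarith
  have hm0 : (0 : ℝ) < m := lt_of_lt_of_le (by positivity) hm
  obtain ⟨M, hS⟩ := exists_summarizes_sspmRun (by exact_mod_cast hm0 : 0 < m) σI hI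
  have hrun : ssQuery (sspmRun m (σI ++ σD)) x = ssQuery (sspmRun m σI) x - delCount σD x := by
    rw [sspmRun, List.foldl_append]
    exact ssQuery_foldl_del m σD hD _ x
  have hins : insCount (σI ++ σD) x = insCount σI x := by
    simp only [insCount, List.countP_append, Nat.add_eq_left, List.countP_eq_zero]
    grind
  have hdel : delCount (σI ++ σD) x = delCount σD x := by
    simp only [delCount, List.countP_append, Nat.add_eq_right, List.countP_eq_zero]
    grind
  have htot : totalI (σI ++ σD) = totalI σI := by
    simp only [totalI, List.countP_append, Nat.add_eq_left, List.countP_eq_zero]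
    grind
  have hvx := hv _ List.prefix_rfl x
  rw [hins, hdel] at hvx
  have herr : |freq (σI ++ σD) x - (ssQuery (sspmRun m (σI ++ σD)) x : ℤ)| ≤ M := by
    rw [freq, hins, hdel, hrun, abs_le]
    have := hS.ssQuery_bounds x
    omega
  have hMm : (M : ℝ) * m ≤ totalI (σI ++ σD) := by
    rw [htot]
    exact_mod_cast hS.mul_le
  have hF : (totalI (σI ++ σD) : ℝ) / α ≤ F1 (σI ++ σD) := by
    have hb' : (totalD (σI ++ σD) : ℝ) ≤ (1 - 1 / α) * totalI (σI ++ σD) := hb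
    have : (1 - 1 / α) * (totalI (σI ++ σD) : ℝ) =
        totalI (σI ++ σD) - totalI (σI ++ σD) / α := by ring
    simp only [F1]
    push_cast
    linarith
  calc |(freq (σI ++ σD) x : ℝ) - (ssQuery (sspmRun m (σI ++ σD)) x : ℝ)| ≤ (M : ℝ) := by
        exact_mod_cast herr
    _ = ε * (M * (α / ε) / α) := by field_simp
    _ ≤ ε * (M * m / α) := by gcongr
    _ ≤ ε * (totalI (σI ++ σD) / α) := by gcongr
    _ ≤ ε * F1 (σI ++ σD) := by gcongr

end SSPM
end
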